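/- For i = 1,2, define α-rows (with coordinates ordered (x₁,x₂,t₁,t₂)): α₁=(0,0,f₂^U,f₁^U), α₂=(0,0,f₂^L,f₁^L), α₃=((f₂^U−f₂^L)w₁, 0, f₂^L−r₁₂(f₂^U−f₂^L)w₁, b₁), α₄=(0,(f₁^U−f₁^L)w₂, b₂, f₁^L−r₂₂(f₁^U−f₁^L)w₂), α₅=((f₂^U−b₂)w₁,(f₁^U−b₁)w₂, b₂−r₁₂(f₂^U−b₂)w₁, b₁−r₂₂(f₁^U−b₁)w₂), α₆=((b₂−f₂^L)w₁,(b₁−f₁^L)w₂, b₂−r₁₁(b₂−f₂^L)w₁, b₁−r₂₁(b₁−f₁^L)w₂), and constants c_j = f₁^U f₂^L − (α_{j1} + α_{j2} p₂₁ + α_{j3} f₁^U + α_{j4} f₂^L) for j = 1,…,6. Then the function g(x₁,x₂,t₁,t₂) = max_{j=1,…,6} (⟨α_j,(x₁,x₂,t₁,t₂)⟩ + c_j) is the convex envelope of the function (x₁,x₂,t₁,t₂) ↦ t₁t₂ over P = P₁×P₂; that is, g ≤ t₁t₂ on P and every convex function h on P with h ≤ t₁t₂ on P satisfies h ≤ g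 on P. -/

import Mathlib

/-- Affine function on `ℝ⁴` (coordinates `(x₁, x₂, t₁, t₂)`) with coefficient row
`(a1, a2, a3, a4)` and constant term `c = f₁ᵁ f₂ᴸ − (a1 + a2 p₂₁ + a3 f₁ᵁ + a4 f₂ᴸ)`. -/
noncomputable def affAlpha (a1 a2 a3 a4 p21 fU1 fL2 : ℝ) (p : ℝ × ℝ × ℝ × ℝ) : ℝ :=
  a1 * p.1 + a2 * p.2.1 + a3 * p.2.2.1 + a4 * p.2.2.2 +
    (fU1 * fL2 - (a1 + a2 * p21 + a3 * fU1 + a4 * fL2))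

/-- Weights for a point of the convex hull of five points in the plane. -/
lemma hull_weights (L U b p q : ℝ) (x t : ℝ)
    (hz : (x, t) ∈ convexHull ℝ ({(0, L), (p, L), (q, b), (1, U), (0, U)} : Set (ℝ × ℝ))) :
    ∃ l0 l1 l2 l3 l4 : ℝ, 0 ≤ l0 ∧ 0 ≤ l1 ∧ 0 ≤ l2 ∧ 0 ≤ l3 ∧ 0 ≤ l4 ∧
      l0 + l1 + l2 + l3 + l4 = 1 ∧ x = p * l1 + q * l2 + l3 ∧
      t = L * l0 + L * l1 + b * l2 + U * l3 + U * l4 := by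
  let S : Set (ℝ × ℝ) := {z | ∃ l0 l1 l2 l3 l4 : ℝ, 0 ≤ l0 ∧ 0 ≤ l1 ∧ 0 ≤ l2 ∧ 0 ≤ l3 ∧ 0 ≤ l4 ∧
      l0 + l1 + l2 + l3 + l4 = 1 ∧ z.1 = p * l1 + q * l2 + l3 ∧
      z.2 = L * l0 + L * l1 + b * l2 + U * l3 + U * l4}
  have hS : Convex ℝ S := by
    rintro ⟨x1, t1⟩ ⟨l0, l1, l2, l3, l4, h0, h1, h2, h3, h4, hs, hx, ht⟩
      ⟨x2, t2⟩ ⟨k0, k1, k2, k3, k4, g0, g1, g2, g3, g4, gs, gx, gt⟩ α β hα hβ hαβ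
    simp only at hx ht gx gt
    refine ⟨α * l0 + β * k0, α * l1 + β * k1, α * l2 + β * k2, α * l3 + β * k3,
      α * l4 + β * k4, by positivity, by positivity, by positivity, by positivity,
      by positivity, ?_, ?_, ?_⟩
    · linear_combination α * hs + β * gs + hαβ
    · simp only [Prod.smul_mk, Prod.mk_add_mk, smul_eq_mul]
      rw [hx, gx]; ring
    · simp only [Prod.smul_mk, Prod.mk_add_mk, smul_eq_mul]
      rw [ht, gt]; ring
  have hsub : ({(0, L), (p, L), (q, b), (1, U), (0, U)} : Set (ℝ × ℝ)) ⊆ S := by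
    intro z hz
    simp only [Set.mem_insert_iff, Set.mem_singleton_iff] at hz
    rcases hz with rfl | rfl | rfl | rfl | rfl
    · exact ⟨1, 0, 0, 0, 0, by norm_num⟩
    · exact ⟨0, 1, 0, 0, 0, by norm_num⟩
    · exact ⟨0, 0, 1, 0, 0, by norm_num⟩
    · exact ⟨0, 0, 0, 1, 0, by norm_num⟩
    · exact ⟨0, 0, 0, 0, 1, by norm_num⟩
  exact convexHull_min hsub hS hz

/-- Shrunken vertices stay in the pentagon. -/
lemma hull_mem (L U b p q θ : ℝ) (hLb : L < b) (hbU : b < U) (h0 : 0 ≤ θ) (h1 : θ ≤ 1)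
    (i : Fin 3) :
    (θ * (![p, q, 1] : Fin 3 → ℝ) i, (![L, b, U] : Fin 3 → ℝ) i) ∈
      convexHull ℝ ({(0, L), (p, L), (q, b), (1, U), (0, U)} : Set (ℝ × ℝ)) := by
  have hc := convex_convexHull ℝ ({(0, L), (p, L), (q, b), (1, U), (0, U)} : Set (ℝ × ℝ))
  have hs := subset_convexHull ℝ ({(0, L), (p, L), (q, b), (1, U), (0, U)} : Set (ℝ × ℝ))
  have key : ∀ X T : ℝ, (X, T) ∈ convexHull ℝ ({(0, L), (p, L), (q, b), (1, U), (0, U)} : Set (ℝ × ℝ)) →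
      (0, T) ∈ convexHull ℝ ({(0, L), (p, L), (q, b), (1, U), (0, U)} : Set (ℝ × ℝ)) →
      (θ * X, T) ∈ convexHull ℝ ({(0, L), (p, L), (q, b), (1, U), (0, U)} : Set (ℝ × ℝ)) := by
    intro X T hX hO
    have := hc hX hO h0 (sub_nonneg.2 h1) (by ring)
    simp only [Prod.smul_mk, Prod.mk_add_mk, smul_eq_mul] at this
    convert this using 2 <;> ring
  have v0 := hs (show ((0 : ℝ), L) ∈ _ by simp)
  have v1 := hs (show (p, L) ∈ _ by simp)
  have v2 := hs (show (q, b) ∈ _ by simp)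
  have v3 := hs (show ((1 : ℝ), U) ∈ _ by simp)
  have v4 := hs (show ((0 : ℝ), U) ∈ _ by simp)
  have v5 : ((0 : ℝ), b) ∈ convexHull ℝ ({(0, L), (p, L), (q, b), (1, U), (0, U)} : Set (ℝ × ℝ)) := by
    have hUL : 0 < U - L := by linarith
    have := hc v0 v4 (a := (U - b) / (U - L)) (b := (b - L) / (U - L))
      (div_nonneg (by linarith) hUL.le) (div_nonneg (by linarith) hUL.le)
      (by field_simp; ring)
    simp only [Prod.smul_mk, Prod.mk_add_mk, smul_eq_mul] at this
    convert this using 2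
    · ring
    · field_simp; ring
  fin_cases i
  · exact key _ _ v1 v0
  · exact key _ _ v2 v5
  · exact key _ _ v3 v4

/-- The extremal law on the three levels `L, b, U`. -/
lemma law_exists (L U b p q x t l0 l1 l2 l3 l4 : ℝ) (hLb : L < b) (hbU : b < U)
    (hp : 0 ≤ p) (hpq : p < q)
    (h0 : 0 ≤ l0) (h1 : 0 ≤ l1) (h2 : 0 ≤ l2) (h3 : 0 ≤ l3) (h4 : 0 ≤ l4)
    (hs : l0 + l1 + l2 + l3 + l4 = 1) (hx : x = p * l1 + q * l2 + l3)
    (ht : t = L * l0 + L * l1 + b * l2 + U * l3 + U * l4) :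
    ∃ a c d θ : ℝ, 0 ≤ a ∧ 0 ≤ c ∧ 0 ≤ d ∧ a + c + d = 1 ∧ t = L * a + b * c + U * d ∧
      0 ≤ θ ∧ θ ≤ 1 ∧ x = θ * (p * a + q * c + d) ∧ (0 < c → θ = 1) := by
  have hUL : 0 < U - L := by linarith
  have hx0 : 0 ≤ x := by rw [hx]; have : 0 ≤ q := by linarith
                         positivity
  obtain ⟨a0, d0, ha0, hd0, had, htad⟩ : ∃ a0 d0 : ℝ, 0 ≤ a0 ∧ 0 ≤ d0 ∧ a0 + d0 = 1 ∧
      t = L * a0 + U * d0 := by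
    refine ⟨l0 + l1 + l2 * ((U - b) / (U - L)), l3 + l4 + l2 * ((b - L) / (U - L)), ?_, ?_, ?_, ?_⟩
    · have : 0 ≤ (U - b) / (U - L) := div_nonneg (by linarith) hUL.le
      positivity
    · have : 0 ≤ (b - L) / (U - L) := div_nonneg (by linarith) hUL.le
      positivity
    · field_simp
      linear_combination (U - L) * hs
    · rw [ht]; field_simp; ring
  rcases le_or_gt x (p * a0 + d0) with hle | hgt
  · rcases eq_or_lt_of_le (show 0 ≤ p * a0 + d0 by positivity) with he | hpos
    · exact ⟨a0, 0, d0, 0, ha0, le_rfl, hd0, by linarith, by linarith, le_rfl, by norm_num,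
        by linarith, fun h => absurd h (lt_irrefl _)⟩
    · exact ⟨a0, 0, d0, x / (p * a0 + d0), ha0, le_rfl, hd0, by linarith, by linarith,
        div_nonneg hx0 hpos.le, (div_le_one hpos).2 hle, by field_simp; ring,
        fun h => absurd h (lt_irrefl _)⟩
  · set X' := p * (l0 + l1) + q * l2 + (l3 + l4) with hX'
    have hxX : x ≤ X' := by rw [hx, hX']; nlinarith [mul_nonneg hp h0]
    set X0 := p * a0 + d0 with hX0
    have hpos : 0 < X' - X0 := by linarith
    obtain ⟨s, hs0, hs1, hsx⟩ : ∃ s : ℝ, 0 ≤ s ∧ s ≤ 1 ∧ x = (1 - s) * X0 + s * X' :=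
      ⟨(x - X0) / (X' - X0), div_nonneg (by linarith) hpos.le,
        (div_le_one hpos).2 (by linarith), by field_simp; ring⟩
    have hs1' : 0 ≤ 1 - s := by linarith
    refine ⟨(1 - s) * a0 + s * (l0 + l1), s * l2, (1 - s) * d0 + s * (l3 + l4), 1,
      by positivity, by positivity, by positivity, ?_, ?_, by norm_num, le_rfl, ?_, fun _ => rfl⟩
    · linear_combination (1 - s) * had + s * hs
    · linear_combination (1 - s) * htad + s * ht
    · rw [hsx, hX', hX0]; ring

/-- All facts needed about one pentagon. -/
lemma pentagon_facts (L U b p q r1 r2 w x t : ℝ) (hLb : L < b) (hbU : b < U)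
    (hp : 0 ≤ p) (hpq : p < q) (hr2 : 0 ≤ r2) (hw : 0 < w)
    (e1 : r1 * (b - L) = q - p) (e2 : r2 * (U - b) = 1 - q) (e3 : w * (r1 - r2) = 1)
    (hz : (x, t) ∈ convexHull ℝ ({(0, L), (p, L), (q, b), (1, U), (0, U)} : Set (ℝ × ℝ))) :
    (L ≤ t ∧ t ≤ U ∧ b + w * (x - q - r2 * (t - b)) ≤ b ∧ b + w * (x - q - r2 * (t - b)) ≤ t) ∧
    ∃ a c d θ : ℝ, 0 ≤ a ∧ 0 ≤ c ∧ 0 ≤ d ∧ a + c + d = 1 ∧ t = L * a + b * c + U * d ∧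
      0 ≤ θ ∧ θ ≤ 1 ∧ x = θ * (p * a + q * c + d) ∧
      (0 < c → b + w * (x - q - r2 * (t - b)) = b - (b - L) * a) := by
  obtain ⟨l0, l1, l2, l3, l4, h0, h1, h2, h3, h4, hs, hx, ht⟩ := hull_weights L U b p q x t hz
  have hu : b + w * (x - q - r2 * (t - b)) = b - (b - L) * (l0 + l1) - w * p * l0 - w * l4 := by
    rw [hx, ht]
    linear_combination (w * q - w * r2 * b) * hs
      + w * (l0 + l1) * e1 - w * (l3 + l4) * e2 - (b - L) * (l0 + l1) * e3
  have hwp : 0 ≤ w * p * l0 := by positivity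
  have hw4 : 0 ≤ w * l4 := by positivity
  refine ⟨⟨?_, ?_, ?_, ?_⟩, ?_⟩
  · have : t - L = (b - L) * l2 + (U - L) * (l3 + l4) := by
      linear_combination ht + L * hs
    have h5 : 0 ≤ (b - L) * l2 := mul_nonneg (by linarith) h2
    have h6 : 0 ≤ (U - L) * (l3 + l4) := mul_nonneg (by linarith) (by linarith)
    linarith
  · have : U - t = (U - b) * l2 + (U - L) * (l0 + l1) := by
      linear_combination -ht - U * hs
    have h5 : 0 ≤ (U - b) * l2 := mul_nonneg (by linarith) h2
    have h6 : 0 ≤ (U - L) * (l0 + l1) := mul_nonneg (by linarith) (by linarith)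
    linarith
  · rw [hu]
    have h5 : 0 ≤ (b - L) * (l0 + l1) := mul_nonneg (by linarith) (by linarith)
    linarith
  · rw [hu]
    have h5 : 0 ≤ (U - b) * (l3 + l4) := mul_nonneg (by linarith) (by linarith)
    have : t - (b - (b - L) * (l0 + l1)) = (U - b) * (l3 + l4) := by
      linear_combination ht + b * hs
    linarith
  · obtain ⟨a, c, d, θ, ha, hc, hd, hacd, ht', hθ, hθ1, hx', hθc⟩ :=
      law_exists L U b p q x t l0 l1 l2 l3 l4 hLb hbU hp hpq h0 h1 h2 h3 h4 hs hx ht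
    refine ⟨a, c, d, θ, ha, hc, hd, hacd, ht', hθ, hθ1, hx', fun h => ?_⟩
    rw [hx', hθc h, ht']
    linear_combination (w * q - w * r2 * b) * hacd + w * a * e1 - w * d * e2 - (b - L) * a * e3

/-- The Jensen inequality for couplings. -/
lemma coupling_jensen (P : Set (ℝ × ℝ × ℝ × ℝ)) (h : ℝ × ℝ × ℝ × ℝ → ℝ) (hc : ConvexOn ℝ P h)
    (hle : ∀ p ∈ P, h p ≤ p.2.2.1 * p.2.2.2) (X1 X2 T1 T2 : Fin 3 → ℝ)
    (hmem : ∀ i j, (X1 i, X2 j, T1 i, T2 j) ∈ P) (a c d A C D : ℝ)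
    (hacd : a + c + d = 1) (q : Fin 3 → Fin 3 → ℝ)
    (hq : ∀ i j, 0 ≤ q i j)
    (r0 : q 0 0 + q 0 1 + q 0 2 = a) (r1 : q 1 0 + q 1 1 + q 1 2 = c)
    (r2 : q 2 0 + q 2 1 + q 2 2 = d)
    (c0 : q 0 0 + q 1 0 + q 2 0 = A) (c1 : q 0 1 + q 1 1 + q 2 1 = C)
    (c2 : q 0 2 + q 1 2 + q 2 2 = D) :
    h (X1 0 * a + X1 1 * c + X1 2 * d, X2 0 * A + X2 1 * C + X2 2 * D,
       T1 0 * a + T1 1 * c + T1 2 * d, T2 0 * A + T2 1 * C + T2 2 * D) ≤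
      ∑ i, ∑ j, q i j * (T1 i * T2 j) := by
  have h1 := hc.map_sum_le (t := Finset.univ) (w := fun k : Fin 3 × Fin 3 => q k.1 k.2)
    (p := fun k => (X1 k.1, X2 k.2, T1 k.1, T2 k.2)) (fun k _ => hq _ _)
    (by simp only [Fintype.sum_prod_type, Fin.sum_univ_three]; linarith) (fun k _ => hmem _ _)
  simp only [Fintype.sum_prod_type, smul_eq_mul] at h1
  have h2 : ∑ i, ∑ j, q i j * h (X1 i, X2 j, T1 i, T2 j) ≤ ∑ i, ∑ j, q i j * (T1 i * T2 j) :=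
    Finset.sum_le_sum fun i _ => Finset.sum_le_sum fun j _ =>
      mul_le_mul_of_nonneg_left (hle _ (hmem i j)) (hq i j)
  refine le_trans (le_of_eq ?_) (h1.trans h2)
  congr 1
  simp only [Fin.sum_univ_three, Prod.smul_mk, Prod.mk_add_mk, smul_eq_mul, Prod.mk.injEq]
  subst r0 r1 r2 c0 c1 c2
  refine ⟨?_, ?_, ?_, ?_⟩ <;> ring

/-- The antimonotone coupling and its value. -/
lemma coupling_exists (L1 b1 U1 L2 b2 U2 t1 t2 a c d A C D : ℝ)
    (ha : 0 ≤ a) (hc : 0 ≤ c) (hd : 0 ≤ d) (hA : 0 ≤ A) (hC : 0 ≤ C) (hD : 0 ≤ D)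
    (hacd : a + c + d = 1) (hACD : A + C + D = 1)
    (ht1 : t1 = L1 * a + b1 * c + U1 * d) (ht2 : t2 = L2 * A + b2 * C + U2 * D)
    (u1 u2 : ℝ) (hu1 : 0 < c → u1 = b1 - (b1 - L1) * a) (hu2 : 0 < C → u2 = b2 - (b2 - L2) * A) :
    ∃ q : Fin 3 → Fin 3 → ℝ, (∀ i j, 0 ≤ q i j) ∧
      q 0 0 + q 0 1 + q 0 2 = a ∧ q 1 0 + q 1 1 + q 1 2 = c ∧ q 2 0 + q 2 1 + q 2 2 = d ∧
      q 0 0 + q 1 0 + q 2 0 = A ∧ q 0 1 + q 1 1 + q 2 1 = C ∧ q 0 2 + q 1 2 + q 2 2 = D ∧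
      ∃ V, (∑ i, ∑ j, q i j * ((![L1, b1, U1] : Fin 3 → ℝ) i * (![L2, b2, U2] : Fin 3 → ℝ) j)) = V ∧
      (V = U2 * t1 + U1 * t2 - U1 * U2 ∨ V = L2 * t1 + L1 * t2 - L1 * L2 ∨
        V = (U2 - L2) * u1 + L2 * t1 + b1 * t2 - b1 * U2 ∨
        V = (U1 - L1) * u2 + L1 * t2 + b2 * t1 - b2 * U1 ∨
        V = (U2 - b2) * u1 + (U1 - b1) * u2 + b2 * t1 + b1 * t2 - U2 * b1 + b1 * b2 - b2 * U1 ∨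
        V = (b2 - L2) * u1 + (b1 - L1) * u2 + L2 * t1 + L1 * t2 - b1 * b2) := by
  have hd' : d = 1 - a - c := by linarith
  have hA' : A = 1 - C - D := by linarith
  by_cases k1 : a + c ≤ D
  · refine ⟨![![0, 0, a], ![0, 0, c], ![A, C, D - a - c]], ?_, ?_, ?_, ?_, ?_, ?_, ?_, _, rfl, Or.inl ?_⟩
    · intro i j
      fin_cases i <;> fin_cases j <;> simp <;> linarith
    all_goals simp only [Fin.sum_univ_three, Matrix.cons_val]
    all_goals first | linarith | (subst_vars; ring)
  by_cases k2 : D + C ≤ a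
  · refine ⟨![![a - C - D, C, D], ![c, 0, 0], ![d, 0, 0]], ?_, ?_, ?_, ?_, ?_, ?_, ?_, _, rfl, Or.inr (Or.inl ?_)⟩
    · intro i j
      fin_cases i <;> fin_cases j <;> simp <;> linarith
    all_goals simp only [Fin.sum_univ_three, Matrix.cons_val]
    all_goals first | linarith | (subst_vars; ring)
  rcases le_total a D with k3 | k3 <;> rcases le_total (D + C) (a + c) with k4 | k4
  · have hu := hu1 (by linarith)
    refine ⟨![![0, 0, a], ![a + c - D - C, C, D - a], ![d, 0, 0]], ?_, ?_, ?_, ?_, ?_, ?_, ?_, _, rfl, Or.inr (Or.inr (Or.inl ?_))⟩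
    · intro i j
      fin_cases i <;> fin_cases j <;> simp <;> linarith
    all_goals simp only [Fin.sum_univ_three, Matrix.cons_val]
    all_goals first | linarith | (subst_vars; ring)
  · have hu := hu1 (by linarith)
    have hv := hu2 (by linarith)
    refine ⟨![![0, 0, a], ![0, a + c - D, D - a], ![A, D + C - a - c, 0]], ?_, ?_, ?_, ?_, ?_, ?_, ?_, _, rfl, Or.inr (Or.inr (Or.inr (Or.inr (Or.inl ?_))))⟩
    · intro i j
      fin_cases i <;> fin_cases j <;> simp <;> linarith
    all_goals simp only [Fin.sum_univ_three, Matrix.cons_val]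
    all_goals first | linarith | (subst_vars; ring)
  · have hu := hu1 (by linarith)
    have hv := hu2 (by linarith)
    refine ⟨![![0, a - D, D], ![a + c - D - C, D + C - a, 0], ![d, 0, 0]], ?_, ?_, ?_, ?_, ?_, ?_, ?_, _, rfl, Or.inr (Or.inr (Or.inr (Or.inr (Or.inr ?_))))⟩
    · intro i j
      fin_cases i <;> fin_cases j <;> simp <;> linarith
    all_goals simp only [Fin.sum_univ_three, Matrix.cons_val]
    all_goals first | linarith | (subst_vars; ring)
  · have hv := hu2 (by linarith)
    refine ⟨![![0, a - D, D], ![0, c, 0], ![A, D + C - a - c, 0]], ?_, ?_, ?_, ?_, ?_, ?_, ?_, _, rfl, Or.inr (Or.inr (Or.inr (Or.inl ?_)))⟩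
    · intro i j
      fin_cases i <;> fin_cases j <;> simp <;> linarith
    all_goals simp only [Fin.sum_univ_three, Matrix.cons_val]
    all_goals first | linarith | (subst_vars; ring)

/-- The six affine functions underestimate the product. -/
lemma under (L1 b1 U1 L2 b2 U2 t1 t2 u1 u2 : ℝ) (h1 : L1 < b1) (h1' : b1 < U1)
    (h2 : L2 < b2) (h2' : b2 < U2) (hL1 : L1 ≤ t1) (hU1 : t1 ≤ U1) (hL2 : L2 ≤ t2) (hU2 : t2 ≤ U2)
    (hu1 : u1 ≤ b1) (hu1' : u1 ≤ t1) (hu2 : u2 ≤ b2) (hu2' : u2 ≤ t2) :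
    U2 * t1 + U1 * t2 - U1 * U2 ≤ t1 * t2 ∧ L2 * t1 + L1 * t2 - L1 * L2 ≤ t1 * t2 ∧
        (U2 - L2) * u1 + L2 * t1 + b1 * t2 - b1 * U2 ≤ t1 * t2 ∧
        (U1 - L1) * u2 + L1 * t2 + b2 * t1 - b2 * U1 ≤ t1 * t2 ∧
        (U2 - b2) * u1 + (U1 - b1) * u2 + b2 * t1 + b1 * t2 - U2 * b1 + b1 * b2 - b2 * U1 ≤ t1 * t2 ∧
        (b2 - L2) * u1 + (b1 - L1) * u2 + L2 * t1 + L1 * t2 - b1 * b2 ≤ t1 * t2 := by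
  have A : ∀ {x y : ℝ}, 0 ≤ x → 0 ≤ y → 0 ≤ x * y := fun hx hy => mul_nonneg hx hy
  have n1 := sub_nonneg.2 hL1
  have n2 := sub_nonneg.2 hU1
  have n3 := sub_nonneg.2 hL2
  have n4 := sub_nonneg.2 hU2
  have m1 := sub_nonneg.2 hu1
  have m1' := sub_nonneg.2 hu1'
  have m2 := sub_nonneg.2 hu2
  have m2' := sub_nonneg.2 hu2'
  have p1 := sub_nonneg.2 h1.le
  have p1' := sub_nonneg.2 h1'.le
  have p2 := sub_nonneg.2 h2.le
  have p2' := sub_nonneg.2 h2'.le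
  refine ⟨by nlinarith [A n2 n4], by nlinarith [A n1 n3], ?_, ?_, ?_, ?_⟩
  · nlinarith [A m1 n3, A m1 n4, A m1' n3, A m1' n4]
  · nlinarith [A m2 n1, A m2 n2, A m2' n1, A m2' n2]
  · rcases le_total t1 b1 with k1 | k1 <;> rcases le_total t2 b2 with k2 | k2 <;>
      have q1 := sub_nonneg.2 k1 <;> have q2 := sub_nonneg.2 k2
    · linarith [A q1 n4, A q2 p1', A p2' m1', A p1' m2']
    · linarith [A q1 n4, A p2' m1', A p1' m2]
    · linarith [A q2 n2, A p2' m1, A p1' m2']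
    · linarith [A q1 q2, A p2' m1, A p1' m2]
  · rcases le_total t1 b1 with k1 | k1 <;> rcases le_total t2 b2 with k2 | k2 <;>
      have q1 := sub_nonneg.2 k1 <;> have q2 := sub_nonneg.2 k2
    · linarith [A q1 q2, A p2 m1', A p1 m2']
    · linarith [A q2 n1, A p2 m1', A p1 m2]
    · linarith [A q1 n3, A p2 m1, A p1 m2']
    · linarith [A q1 n3, A q2 p1, A p2 m1, A p1 m2]

/-- Basic facts about the slopes. -/
lemma slopes (L U b p q r1 r2 w : ℝ) (hLb : L < b) (hbU : b < U) (hpq : p < q) (hq : q ≤ 1)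
    (hconv : (b - L) / (q - p) < (U - b) / (1 - q)) (h1 : r1 = (q - p) / (b - L))
    (h2 : r2 = (1 - q) / (U - b)) (hw : w = 1 / (r1 - r2)) :
    0 ≤ r2 ∧ 0 < w ∧ r1 * (b - L) = q - p ∧ r2 * (U - b) = 1 - q ∧ w * (r1 - r2) = 1 := by
  have a1 : 0 < b - L := by linarith
  have a2 : 0 < U - b := by linarith
  have a3 : 0 < q - p := by linarith
  have a4 : 0 < 1 - q := by
    rcases eq_or_lt_of_le hq with rfl | h
    · simp only [sub_self, div_zero] at hconv
      have := div_pos a1 a3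
      linarith
    · linarith
  have hlt : r2 < r1 := by
    rw [div_lt_div_iff₀ a3 a4] at hconv
    rw [h1, h2, div_lt_div_iff₀ a2 a1]
    linarith
  have a5 : 0 < r1 - r2 := by linarith
  refine ⟨h2 ▸ (div_pos a4 a2).le, hw ▸ one_div_pos.2 a5, ?_, ?_, ?_⟩
  · rw [h1]; field_simp
  · rw [h2]; field_simp
  · rw [hw]; field_simp

/-- The pointwise maximum of the six affine functions `⟨α_j, ·⟩ + c_j` is the convex
envelope of `(x₁,x₂,t₁,t₂) ↦ t₁ t₂` over the product of pentagons `P = P₁ × P₂`. -/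
theorem pentagon_product_convex_envelope
    (fL1 fU1 b1 p11 p12 fL2 fU2 b2 p21 p22 : ℝ)
    (hb1 : fL1 < b1) (hb1' : b1 < fU1) (hb2 : fL2 < b2) (hb2' : b2 < fU2)
    (hp11 : 0 ≤ p11) (hp12 : p11 < p12) (hp13 : p12 ≤ 1)
    (hp21 : 0 ≤ p21) (hp22 : p21 < p22) (hp23 : p22 ≤ 1)
    (hconv1 : (b1 - fL1) / (p12 - p11) < (fU1 - b1) / (1 - p12))
    (hconv2 : (b2 - fL2) / (p22 - p21) < (fU2 - b2) / (1 - p22))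
    (r11 r12 w1 r21 r22 w2 : ℝ)
    (hr11 : r11 = (p12 - p11) / (b1 - fL1))
    (hr12 : r12 = (1 - p12) / (fU1 - b1))
    (hw1 : w1 = 1 / (r11 - r12))
    (hr21 : r21 = (p22 - p21) / (b2 - fL2))
    (hr22 : r22 = (1 - p22) / (fU2 - b2))
    (hw2 : w2 = 1 / (r21 - r22))
    (P1 P2 : Set (ℝ × ℝ))
    (hP1 : P1 = convexHull ℝ ({(0, fL1), (p11, fL1), (p12, b1), (1, fU1), (0, fU1)} : Set (ℝ × ℝ)))
    (hP2 : P2 = convexHull ℝ ({(0, fL2), (p21, fL2), (p22, b2), (1, fU2), (0, fU2)} : Set (ℝ × ℝ)))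
    (P : Set (ℝ × ℝ × ℝ × ℝ))
    (hP : P = {p : ℝ × ℝ × ℝ × ℝ | (p.1, p.2.2.1) ∈ P1 ∧ (p.2.1, p.2.2.2) ∈ P2})
    (g : ℝ × ℝ × ℝ × ℝ → ℝ)
    (hg : ∀ p, g p =
      max (max (max (max (max
        (affAlpha 0 0 fU2 fU1 p21 fU1 fL2 p)
        (affAlpha 0 0 fL2 fL1 p21 fU1 fL2 p))
        (affAlpha ((fU2 - fL2) * w1) 0 (fL2 - r12 * (fU2 - fL2) * w1) b1 p21 fU1 fL2 p))
        (affAlpha 0 ((fU1 - fL1) * w2) b2 (fL1 - r22 * (fU1 - fL1) * w2) p21 fU1 fL2 p))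
        (affAlpha ((fU2 - b2) * w1) ((fU1 - b1) * w2)
          (b2 - r12 * (fU2 - b2) * w1) (b1 - r22 * (fU1 - b1) * w2) p21 fU1 fL2 p))
        (affAlpha ((b2 - fL2) * w1) ((b1 - fL1) * w2)
          (b2 - r11 * (b2 - fL2) * w1) (b1 - r21 * (b1 - fL1) * w2) p21 fU1 fL2 p)) :
    (∀ p ∈ P, g p ≤ p.2.2.1 * p.2.2.2) ∧
      ∀ h : ℝ × ℝ × ℝ × ℝ → ℝ, ConvexOn ℝ P h →
        (∀ p ∈ P, h p ≤ p.2.2.1 * p.2.2.2) → ∀ p ∈ P, h p ≤ g p := by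
  obtain ⟨hr1, hw1p, e11, e12, e13⟩ := slopes fL1 fU1 b1 p11 p12 r11 r12 w1 hb1 hb1' hp12 hp13 hconv1 hr11 hr12 hw1
  obtain ⟨hr2, hw2p, e21, e22, e23⟩ := slopes fL2 fU2 b2 p21 p22 r21 r22 w2 hb2 hb2' hp22 hp23 hconv2 hr21 hr22 hw2
  clear hr11 hr12 hw1 hr21 hr22 hw2 hconv1 hconv2
  have hg' : ∀ x1 x2 t1 t2 : ℝ, g (x1, x2, t1, t2) =
      max (max (max (max (max
        (fU2 * t1 + fU1 * t2 - fU1 * fU2)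
        (fL2 * t1 + fL1 * t2 - fL1 * fL2))
        ((fU2 - fL2) * (b1 + w1 * (x1 - p12 - r12 * (t1 - b1))) + fL2 * t1 + b1 * t2 - b1 * fU2))
        ((fU1 - fL1) * (b2 + w2 * (x2 - p22 - r22 * (t2 - b2))) + fL1 * t2 + b2 * t1 - b2 * fU1))
        ((fU2 - b2) * (b1 + w1 * (x1 - p12 - r12 * (t1 - b1)))
          + (fU1 - b1) * (b2 + w2 * (x2 - p22 - r22 * (t2 - b2)))
          + b2 * t1 + b1 * t2 - fU2 * b1 + b1 * b2 - b2 * fU1))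
        ((b2 - fL2) * (b1 + w1 * (x1 - p12 - r12 * (t1 - b1)))
          + (b1 - fL1) * (b2 + w2 * (x2 - p22 - r22 * (t2 - b2)))
          + fL2 * t1 + fL1 * t2 - b1 * b2) := by
    intro x1 x2 t1 t2
    rw [hg]
    unfold affAlpha
    simp only
    congr 1
    · congr 1
      · congr 1
        · congr 1
          · congr 1 <;> ring
          · linear_combination (fU2 - fL2) * w1 * e12
        · linear_combination -(fU1 - fL1) * w2 * e21 + (fU1 - fL1) * (b2 - fL2) * e23
      · linear_combination (fU2 - b2) * w1 * e12 - (fU1 - b1) * w2 * e21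
          + (fU1 - b1) * (b2 - fL2) * e23
    · linear_combination (b2 - fL2) * w1 * e12 - (b1 - fL1) * w2 * e21
        + (b2 - fL2) * (fU1 - t1) * e13 + (b1 - fL1) * (fL2 - t2) * e23
        + (b1 - fL1) * (b2 - fL2) * e23
  subst hP1 hP2 hP
  constructor
  · rintro ⟨x1, x2, t1, t2⟩ ⟨m1, m2⟩
    obtain ⟨⟨i1, i2, i3, i4⟩, -⟩ := pentagon_facts fL1 fU1 b1 p11 p12 r11 r12 w1 x1 t1 hb1 hb1' hp11 hp12
      hr1 hw1p e11 e12 e13 m1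
    obtain ⟨⟨j1, j2, j3, j4⟩, -⟩ := pentagon_facts fL2 fU2 b2 p21 p22 r21 r22 w2 x2 t2 hb2 hb2' hp21 hp22
      hr2 hw2p e21 e22 e23 m2
    rw [hg']
    obtain ⟨k1, k2, k3, k4, k5, k6⟩ := under fL1 b1 fU1 fL2 b2 fU2 t1 t2 _ _ hb1 hb1' hb2 hb2'
      i1 i2 j1 j2 i3 i4 j3 j4
    exact max_le (max_le (max_le (max_le (max_le k1 k2) k3) k4) k5) k6
  · rintro h hconv hle ⟨x1, x2, t1, t2⟩ ⟨m1, m2⟩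
    obtain ⟨-, a, c, d, θ, ha, hc, hd, hacd, ht1, hθ0, hθ1, hx1, hu1⟩ :=
      pentagon_facts fL1 fU1 b1 p11 p12 r11 r12 w1 x1 t1 hb1 hb1' hp11 hp12
      hr1 hw1p e11 e12 e13 m1
    obtain ⟨-, A, C, D, η, hA, hC, hD, hACD, ht2, hη0, hη1, hx2, hu2⟩ :=
      pentagon_facts fL2 fU2 b2 p21 p22 r21 r22 w2 x2 t2 hb2 hb2' hp21 hp22
      hr2 hw2p e21 e22 e23 m2
    rw [hg']
    obtain ⟨q, hq, s1, s2, s3, s4, s5, s6, V, hV, hcase⟩ :=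
      coupling_exists fL1 b1 fU1 fL2 b2 fU2 t1 t2 a c d A C D ha hc hd hA hC hD hacd hACD
        ht1 ht2 _ _ hu1 hu2
    have hJ := coupling_jensen _ h hconv hle (fun i => θ * (![p11, p12, 1] : Fin 3 → ℝ) i)
      (fun i => η * (![p21, p22, 1] : Fin 3 → ℝ) i) ![fL1, b1, fU1] ![fL2, b2, fU2]
      (fun i j => ⟨hull_mem fL1 fU1 b1 p11 p12 θ hb1 hb1' hθ0 hθ1 i,
        hull_mem fL2 fU2 b2 p21 p22 η hb2 hb2' hη0 hη1 j⟩)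
      a c d A C D hacd q hq s1 s2 s3 s4 s5 s6
    rw [hV] at hJ
    have hpt : ((θ * (![p11, p12, 1] : Fin 3 → ℝ) 0) * a + (θ * (![p11, p12, 1] : Fin 3 → ℝ) 1) * c
          + (θ * (![p11, p12, 1] : Fin 3 → ℝ) 2) * d,
        (η * (![p21, p22, 1] : Fin 3 → ℝ) 0) * A + (η * (![p21, p22, 1] : Fin 3 → ℝ) 1) * C
          + (η * (![p21, p22, 1] : Fin 3 → ℝ) 2) * D,
        (![fL1, b1, fU1] : Fin 3 → ℝ) 0 * a + (![fL1, b1, fU1] : Fin 3 → ℝ) 1 * c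
          + (![fL1, b1, fU1] : Fin 3 → ℝ) 2 * d,
        (![fL2, b2, fU2] : Fin 3 → ℝ) 0 * A + (![fL2, b2, fU2] : Fin 3 → ℝ) 1 * C
          + (![fL2, b2, fU2] : Fin 3 → ℝ) 2 * D) = (x1, x2, t1, t2) := by
      simp only [Matrix.cons_val, Prod.mk.injEq]
      refine ⟨?_, ?_, ht1.symm, ht2.symm⟩
      · rw [hx1]; ring
      · rw [hx2]; ring
    rw [hpt] at hJ
    refine hJ.trans ?_
    simp only [le_max_iff]
    rcases hcase with k | k | k | k | k | k
    · exact Or.inl (Or.inl (Or.inl (Or.inl (Or.inl k.le))))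
    · exact Or.inl (Or.inl (Or.inl (Or.inl (Or.inr k.le))))
    · exact Or.inl (Or.inl (Or.inl (Or.inr k.le)))
    · exact Or.inl (Or.inl (Or.inr k.le))
    · exact Or.inl (Or.inr k.le)
    · exact Or.inr k.le
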